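/- arXiv:2603.06249 — 2 statements merged into one kernel-verified Lean document; each statement's English description precedes it below -/
import Mathlib

section
/- For all integers k ≥ 1 and n > 2k, the function B₀^{2*_k} is integrable on ℝⁿ and the k-th order Dirichlet energy of B₀ equals its critical L^{2*_k} norm to the power 2*_k: if k is even, then ∫_{ℝⁿ} (Δ₀^{k/2} B₀)² dx = ∫_{ℝⁿ} B₀^{2*_k} dx, and if k is odd, then ∫_{ℝⁿ} |∇(Δ₀^{(k−1)/2} B₀)|² dx = ∫_{ℝⁿ} B₀^{2*_k} dx, all integrals being finite. -/
open MeasureTheory Real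

/-- The constant `𝔠_{n,k} := (∏_{j=-k}^{k-1} (n+2j))^{1/k}` (reindexed by `j ↦ j - k`). -/
noncomputable def cnk (n k : ℕ) : ℝ :=
  (∏ j ∈ Finset.range (2 * k), ((n : ℝ) + 2 * j - 2 * k)) ^ ((k : ℝ)⁻¹)

/-- The canonical bubble `B₀(x) = (1 + 𝔠_{n,k}⁻¹ |x|²)^{(2k-n)/2}` on `ℝⁿ`. -/
noncomputable def canonicalBubble (n k : ℕ) (x : EuclideanSpace ℝ (Fin n)) : ℝ :=
  (1 + (cnk n k)⁻¹ * ‖x‖ ^ 2) ^ (((2 * k : ℝ) - n) / 2)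

/-- The geometers' Laplacian `Δ₀ = -∑ ∂²/∂xᵢ²` on `ℝⁿ`. -/
noncomputable def lap (n : ℕ) (f : EuclideanSpace ℝ (Fin n) → ℝ) :
    EuclideanSpace ℝ (Fin n) → ℝ :=
  fun x => -∑ i : Fin n, iteratedFDeriv ℝ 2 f x (fun _ => EuclideanSpace.single i 1)

open Filter Topology Set InnerProductSpace

/-- The power `(1 + a |x|²)^{-s}` on `ℝⁿ`. -/
noncomputable def bracketPow (n : ℕ) (a s : ℝ) (x : EuclideanSpace ℝ (Fin n)) : ℝ :=
  (1 + a * ‖x‖ ^ 2) ^ (-s)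

section BracketPow

variable {n : ℕ} {a : ℝ}

lemma bracket_pos (ha : 0 < a) (x : EuclideanSpace ℝ (Fin n)) : 0 < 1 + a * ‖x‖ ^ 2 := by
  positivity

lemma bracketPow_mul (ha : 0 < a) (s t : ℝ) (x : EuclideanSpace ℝ (Fin n)) :
    bracketPow n a s x * bracketPow n a t x = bracketPow n a (s + t) x := by
  rw [bracketPow, bracketPow, bracketPow, ← rpow_add (bracket_pos ha x), neg_add]

lemma bracket_mul_bracketPow (ha : 0 < a) (s : ℝ) (x : EuclideanSpace ℝ (Fin n)) :
    (1 + a * ‖x‖ ^ 2) * bracketPow n a (s + 1) x = bracketPow n a s x := by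
  have h := bracketPow_mul ha (-1) (s + 1) x
  rw [neg_add_cancel_comm_assoc] at h
  rw [← h]
  simp [bracketPow]

lemma contDiff_bracketPow (ha : 0 < a) (s : ℝ) {m : WithTop ℕ∞} :
    ContDiff ℝ m (bracketPow n a s) := by
  unfold bracketPow
  refine ContDiff.rpow_const_of_ne ?_ fun x => (bracket_pos ha x).ne'
  exact contDiff_const.add (contDiff_const.mul (contDiff_norm_sq ℝ))

lemma hasFDerivAt_bracketPow (ha : 0 < a) (s : ℝ) (x : EuclideanSpace ℝ (Fin n)) :
    HasFDerivAt (bracketPow n a s) ((-2 * a * s * bracketPow n a (s + 1) x) • innerSL ℝ x) x := by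
  have h := (((hasStrictFDerivAt_norm_sq x).hasFDerivAt.const_mul a).const_add 1).rpow_const
    (p := -s) (Or.inl (bracket_pos ha x).ne')
  refine h.congr_fderiv ?_
  ext y
  simp [bracketPow, sub_eq_add_neg, add_comm (-1) (-s)]
  ring

lemma fderiv_bracketPow (ha : 0 < a) (s : ℝ) :
    fderiv ℝ (bracketPow n a s) =
      fun x => (-2 * a * s * bracketPow n a (s + 1) x) • innerSL ℝ x :=
  funext fun x => (hasFDerivAt_bracketPow ha s x).fderiv

lemma lap_bracketPow (ha : 0 < a) (s : ℝ) :
    lap n (bracketPow n a s) =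
      (2 * a * s * (n - 2 * s - 2)) • bracketPow n a (s + 1) +
        (4 * a * s * (s + 1)) • bracketPow n a (s + 2) := by
  ext x
  have key : ∀ i : Fin n, iteratedFDeriv ℝ 2 (bracketPow n a s) x
      (fun _ => EuclideanSpace.single i 1) =
      -2 * a * s * bracketPow n a (s + 1) x +
        4 * a ^ 2 * s * (s + 1) * bracketPow n a (s + 2) x * x i ^ 2 := by
    intro i
    rw [iteratedFDeriv_two_apply, fderiv_bracketPow ha]
    have h := ((hasFDerivAt_bracketPow ha (s + 1) x).const_mul (-2 * a * s)).fun_smul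
      (innerSL ℝ (E := EuclideanSpace ℝ (Fin n))).hasFDerivAt
    rw [h.fderiv]
    have hL (y z : EuclideanSpace ℝ (Fin n)) :
        (innerSL ℝ : EuclideanSpace ℝ (Fin n) →L[ℝ] _ →L[ℝ] ℝ) y z = ⟪y, z⟫_ℝ := rfl
    simp [hL, PiLp.inner_apply, show s + 1 + 1 = s + 2 by ring]
    ring
  simp only [lap, key, Finset.sum_add_distrib, ← Finset.mul_sum, ← EuclideanSpace.real_norm_sq_eq]
  have h := bracket_mul_bracketPow ha (s + 1) x
  rw [show s + 1 + 1 = s + 2 by ring] at h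
  simp only [Finset.sum_const, Finset.card_univ, Fintype.card_fin, nsmul_eq_mul, Pi.add_apply,
    Pi.smul_apply, smul_eq_mul]
  linear_combination -(4 * a * s * (s + 1)) * h

lemma integrable_bracketPow (ha : 0 < a) {p : ℝ} (hp : (n : ℝ) < 2 * p) :
    Integrable (bracketPow n a p) := by
  have h := (integrable_rpow_neg_one_add_norm_sq (E := EuclideanSpace ℝ (Fin n)) (μ := volume)
    (r := 2 * p) (by simpa using hp)).comp_smul (sqrt_pos.2 ha).ne'
  refine h.congr (ae_of_all _ fun x => ?_)
  simp only [bracketPow, norm_smul, mul_pow, norm_eq_abs, sq_abs, sq_sqrt ha.le]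
  congr 1
  ring

lemma integral_bracketPow_succ (hn : 0 < n) (ha : 0 < a) {p : ℝ} (hp : (n : ℝ) < 2 * p) :
    2 * p * ∫ x, bracketPow n a (p + 1) x = (2 * p - n) * ∫ x, bracketPow n a p x := by
  have : Nonempty (Fin n) := ⟨⟨0, hn⟩⟩
  have hI := integrable_bracketPow (n := n) ha hp
  have hI' := integrable_bracketPow (n := n) (p := p + 1) ha (by linarith)
  unfold bracketPow at *
  rw [integral_fun_norm_addHaar volume (fun r => (1 + a * r ^ 2) ^ (-p)),
    integral_fun_norm_addHaar volume (fun r => (1 + a * r ^ 2) ^ (-(p + 1)))]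
  rw [integrable_fun_norm_addHaar volume (f := fun r => (1 + a * r ^ 2) ^ (-p))] at hI
  rw [integrable_fun_norm_addHaar volume (f := fun r => (1 + a * r ^ 2) ^ (-(p + 1)))] at hI'
  simp only [finrank_euclideanSpace, Fintype.card_fin, smul_eq_mul, nsmul_eq_mul] at *
  have hpos : ∀ r : ℝ, 0 < 1 + a * r ^ 2 := fun r => by positivity
  have hderiv : ∀ r ∈ Ici (0 : ℝ), HasDerivAt (fun r : ℝ => r ^ n * (1 + a * r ^ 2) ^ (-p))
      (2 * p * (r ^ (n - 1) * (1 + a * r ^ 2) ^ (-(p + 1))) -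
        (2 * p - n) * (r ^ (n - 1) * (1 + a * r ^ 2) ^ (-p))) r := by
    intro r _
    have h := (hasDerivAt_pow n r).mul
      ((((hasDerivAt_pow 2 r).const_mul a).const_add 1).rpow_const (p := -p)
        (Or.inl (hpos r).ne'))
    convert! h using 1
    have e : (1 + a * r ^ 2) ^ (-p) = (1 + a * r ^ 2) * (1 + a * r ^ 2) ^ (-p - 1) := by
      rw [← rpow_one_add' (hpos r).le (by linarith)]
      · ring_nf
    obtain ⟨m, rfl⟩ : ∃ m, n = m + 1 := ⟨n - 1, by omega⟩
    rw [show -(p + 1) = -p - 1 by ring, e]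
    simp only [Nat.add_sub_cancel]
    push_cast
    ring
  have hlim : Tendsto (fun r : ℝ => r ^ n * (1 + a * r ^ 2) ^ (-p)) atTop (𝓝 0) := by
    have h0 : Tendsto (fun r : ℝ => a ^ (-p) * r ^ (-(2 * p - n))) atTop (𝓝 0) := by
      simpa using (tendsto_rpow_neg_atTop (sub_pos.2 hp)).const_mul (a ^ (-p))
    refine squeeze_zero' ?_ ?_ h0
    · filter_upwards [eventually_gt_atTop 0] with r hr
      have := hpos r
      positivity
    · filter_upwards [eventually_gt_atTop 0] with r hr
      have h1 : (1 + a * r ^ 2) ^ (-p) ≤ (a * r ^ 2) ^ (-p) :=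
        rpow_le_rpow_of_nonpos (by positivity) (by linarith)
          (by have : (0 : ℝ) ≤ n := n.cast_nonneg
              linarith)
      calc r ^ n * (1 + a * r ^ 2) ^ (-p) ≤ r ^ n * (a * r ^ 2) ^ (-p) := by gcongr
        _ = a ^ (-p) * r ^ (-(2 * p - n)) := by
          rw [mul_rpow ha.le (by positivity), ← rpow_natCast r n, ← rpow_natCast r 2,
            ← rpow_mul hr.le, mul_left_comm, ← rpow_add hr]
          congr 2
          push_cast
          ring
  have h := integral_Ioi_of_hasDerivAt_of_tendsto' hderiv
    ((hI'.const_mul _).sub (hI.const_mul _)) hlim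
  rw [integral_sub (hI'.const_mul _) (hI.const_mul _), integral_const_mul, integral_const_mul,
    zero_pow hn.ne', zero_mul, sub_zero] at h
  linear_combination
    (n : ℝ) * volume.real (Metric.ball (0 : EuclideanSpace ℝ (Fin n)) 1) * h

lemma integral_mul_lap_bracketPow (hn : 0 < n) (ha : 0 < a) {s t : ℝ}
    (hst : (n : ℝ) < 2 * (s + t + 1)) :
    Integrable (fun x => bracketPow n a s x * lap n (bracketPow n a t) x) ∧
    Integrable (fun x => ⟪gradient (bracketPow n a s) x, gradient (bracketPow n a t) x⟫_ℝ) ∧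
    ∫ x, bracketPow n a s x * lap n (bracketPow n a t) x =
      ∫ x, ⟪gradient (bracketPow n a s) x, gradient (bracketPow n a t) x⟫_ℝ := by
  have hI := integrable_bracketPow (n := n) ha hst
  have hI' := integrable_bracketPow (n := n) (p := s + t + 1 + 1) ha (by linarith)
  have e1 : (fun x => bracketPow n a s x * lap n (bracketPow n a t) x) = fun x =>
      2 * a * t * (n - 2 * t - 2) * bracketPow n a (s + t + 1) x +
        4 * a * t * (t + 1) * bracketPow n a (s + t + 1 + 1) x := by
    ext x
    have h1 := bracketPow_mul ha s (t + 1) x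
    have h2 := bracketPow_mul ha s (t + 2) x
    rw [← add_assoc] at h1
    rw [show s + (t + 2) = s + t + 1 + 1 by ring] at h2
    simp only [lap_bracketPow ha, Pi.add_apply, Pi.smul_apply, smul_eq_mul]
    linear_combination (2 * a * t * (n - 2 * t - 2)) * h1 + (4 * a * t * (t + 1)) * h2
  have e2 : (fun x => ⟪gradient (bracketPow n a s) x, gradient (bracketPow n a t) x⟫_ℝ) =
      fun x => 4 * a * s * t * bracketPow n a (s + t + 1) x -
        4 * a * s * t * bracketPow n a (s + t + 1 + 1) x := by
    ext x
    have h1 := bracketPow_mul ha (s + 1) (t + 1) x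
    have h2 := bracket_mul_bracketPow ha (s + t + 1) x
    rw [show s + 1 + (t + 1) = s + t + 1 + 1 by ring] at h1
    rw [inner_gradient_left, fderiv_bracketPow ha]
    simp only [smul_apply, smul_eq_mul, innerSL_apply_apply,
      inner_gradient_right, fderiv_bracketPow ha, real_inner_self_eq_norm_sq, conj_trivial]
    linear_combination (4 * a ^ 2 * s * t * ‖x‖ ^ 2) * h1 + (4 * a * s * t) * h2
  rw [e1, e2]
  refine ⟨(hI.const_mul _).add (hI'.const_mul _), (hI.const_mul _).sub (hI'.const_mul _), ?_⟩
  rw [integral_add (hI.const_mul _) (hI'.const_mul _),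
    integral_sub (hI.const_mul _) (hI'.const_mul _)]
  simp only [integral_const_mul]
  linear_combination (2 * a * t) * integral_bracketPow_succ hn ha hst

/-- The span of the functions `(1 + a |x|²)^{-s}` with `s ≥ q`. -/
noncomputable def bracketSpan (n : ℕ) (a q : ℝ) :
    Submodule ℝ (EuclideanSpace ℝ (Fin n) → ℝ) :=
  Submodule.span ℝ (bracketPow n a '' Ici q)

lemma bracketPow_mem_bracketSpan {q s : ℝ} (h : q ≤ s) :
    bracketPow n a s ∈ bracketSpan n a q :=
  Submodule.subset_span ⟨s, h, rfl⟩

lemma contDiff_of_mem_bracketSpan (ha : 0 < a) {q : ℝ} {f : EuclideanSpace ℝ (Fin n) → ℝ}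
    (hf : f ∈ bracketSpan n a q) {m : WithTop ℕ∞} : ContDiff ℝ m f := by
  induction hf using Submodule.span_induction with
  | mem f hf =>
    obtain ⟨s, -, rfl⟩ := hf
    exact contDiff_bracketPow ha s
  | zero => exact contDiff_const
  | add f g _ _ hf hg => exact hf.add hg
  | smul c f _ hf => exact contDiff_const.smul hf

lemma lap_eq_neg_laplacian (f : EuclideanSpace ℝ (Fin n) → ℝ) :
    lap n f = -Laplacian.laplacian f := by
  ext x
  rw [lap, laplacian_eq_iteratedFDeriv_orthonormalBasis f (EuclideanSpace.basisFun (Fin n) ℝ)]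
  simp only [Pi.neg_apply, neg_inj]
  refine Finset.sum_congr rfl fun i _ => ?_
  congr 1
  ext j : 1
  fin_cases j <;> simp

lemma lap_add {f g : EuclideanSpace ℝ (Fin n) → ℝ} (hf : ContDiff ℝ 2 f) (hg : ContDiff ℝ 2 g) :
    lap n (f + g) = lap n f + lap n g := by
  ext x
  simp only [lap_eq_neg_laplacian, Pi.neg_apply, Pi.add_apply,
    hf.contDiffAt.laplacian_add hg.contDiffAt]
  ring

lemma lap_smul {f : EuclideanSpace ℝ (Fin n) → ℝ} (c : ℝ) (hf : ContDiff ℝ 2 f) :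
    lap n (c • f) = c • lap n f := by
  ext x
  simp [lap_eq_neg_laplacian, laplacian_smul c hf.contDiffAt]

lemma lap_zero : lap n 0 = 0 := by
  simpa using lap_smul (n := n) (f := 0) 0 contDiff_const

lemma lap_sum {ι : Type*} (S : Finset ι) {f : ι → EuclideanSpace ℝ (Fin n) → ℝ}
    (hf : ∀ i, ContDiff ℝ 2 (f i)) : lap n (∑ i ∈ S, f i) = ∑ i ∈ S, lap n (f i) := by
  classical
  induction S using Finset.induction_on with
  | empty => simpa using lap_zero
  | insert i S hi ih =>
    have hS : ContDiff ℝ 2 (∑ i ∈ S, f i) := by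
      convert! ContDiff.sum (s := S) fun i _ => hf i using 1
      ext
      simp
    rw [Finset.sum_insert hi, Finset.sum_insert hi, lap_add (hf i) hS, ih]

lemma gradient_add {f g : EuclideanSpace ℝ (Fin n) → ℝ} {x : EuclideanSpace ℝ (Fin n)}
    (hf : DifferentiableAt ℝ f x) (hg : DifferentiableAt ℝ g x) :
    gradient (f + g) x = gradient f x + gradient g x := by
  simp [gradient, fderiv_add hf hg]

lemma gradient_smul {f : EuclideanSpace ℝ (Fin n) → ℝ} {x : EuclideanSpace ℝ (Fin n)} (c : ℝ)
    (hf : DifferentiableAt ℝ f x) : gradient (c • f) x = c • gradient f x := by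
  simp [gradient, fderiv_const_smul hf]

lemma lap_mem_bracketSpan (ha : 0 < a) {q : ℝ} {f : EuclideanSpace ℝ (Fin n) → ℝ}
    (hf : f ∈ bracketSpan n a q) : lap n f ∈ bracketSpan n a (q + 1) := by
  induction hf using Submodule.span_induction with
  | mem f hf =>
    obtain ⟨s, hs, rfl⟩ := hf
    have hs : q ≤ s := hs
    rw [lap_bracketPow ha]
    exact Submodule.add_mem _
      (Submodule.smul_mem _ _ (bracketPow_mem_bracketSpan (by linarith)))
      (Submodule.smul_mem _ _ (bracketPow_mem_bracketSpan (by linarith)))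
  | zero => simpa only [lap_zero] using Submodule.zero_mem _
  | add f g hf hg hf' hg' =>
    rw [lap_add (contDiff_of_mem_bracketSpan ha hf) (contDiff_of_mem_bracketSpan ha hg)]
    exact Submodule.add_mem _ hf' hg'
  | smul c f hf hf' =>
    rw [lap_smul c (contDiff_of_mem_bracketSpan ha hf)]
    exact Submodule.smul_mem _ c hf'

lemma integral_mul_lap_of_mem_bracketSpan (hn : 0 < n) (ha : 0 < a) {q r : ℝ}
    (hqr : (n : ℝ) < 2 * (q + r + 1)) {f g : EuclideanSpace ℝ (Fin n) → ℝ}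
    (hf : f ∈ bracketSpan n a q) (hg : g ∈ bracketSpan n a r) :
    Integrable (fun x => f x * lap n g x) ∧
    Integrable (fun x => ⟪gradient f x, gradient g x⟫_ℝ) ∧
    ∫ x, f x * lap n g x = ∫ x, ⟪gradient f x, gradient g x⟫_ℝ := by
  have hd : ∀ {p : ℝ} {h : EuclideanSpace ℝ (Fin n) → ℝ}, h ∈ bracketSpan n a p →
      Differentiable ℝ h := fun hh =>
    (contDiff_of_mem_bracketSpan ha hh (m := 1)).differentiable one_ne_zero
  have grad_zero : gradient (0 : EuclideanSpace ℝ (Fin n) → ℝ) = 0 := by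
    ext1 x
    simpa using gradient_smul (f := (0 : EuclideanSpace ℝ (Fin n) → ℝ)) (x := x) 0
      (differentiableAt_const 0)
  induction hf, hg using Submodule.span_induction₂ with
  | mem_mem f g hf hg =>
    obtain ⟨s, hs, rfl⟩ := hf
    obtain ⟨t, ht, rfl⟩ := hg
    have hs : q ≤ s := hs
    have ht : r ≤ t := ht
    exact integral_mul_lap_bracketPow hn ha (by linarith)
  | zero_left g hg => simp [grad_zero]
  | zero_right f hf => simp [grad_zero, lap_zero]
  | add_left f g h hf hg hh h1 h2 =>
    simp only [gradient_add (hd hf _) (hd hg _), Pi.add_apply, add_mul, inner_add_left]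
    refine ⟨h1.1.add h2.1, h1.2.1.add h2.2.1, ?_⟩
    rw [integral_add h1.1 h2.1, integral_add h1.2.1 h2.2.1, h1.2.2, h2.2.2]
  | add_right f g h hf hg hh h1 h2 =>
    simp only [gradient_add (hd hg _) (hd hh _), Pi.add_apply, mul_add, inner_add_right,
      lap_add (contDiff_of_mem_bracketSpan ha hg) (contDiff_of_mem_bracketSpan ha hh)]
    refine ⟨h1.1.add h2.1, h1.2.1.add h2.2.1, ?_⟩
    rw [integral_add h1.1 h2.1, integral_add h1.2.1 h2.2.1, h1.2.2, h2.2.2]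
  | smul_left c f g hf hg h =>
    simp only [gradient_smul c (hd hf _), Pi.smul_apply, smul_eq_mul, mul_assoc,
      real_inner_smul_left]
    refine ⟨h.1.const_mul c, h.2.1.const_mul c, ?_⟩
    rw [integral_const_mul, integral_const_mul, h.2.2]
  | smul_right c f g hf hg h =>
    simp only [gradient_smul c (hd hg _), Pi.smul_apply, smul_eq_mul, mul_left_comm,
      real_inner_smul_right, lap_smul c (contDiff_of_mem_bracketSpan ha hg)]
    refine ⟨h.1.const_mul c, h.2.1.const_mul c, ?_⟩
    rw [integral_const_mul, integral_const_mul, h.2.2]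

lemma lap_iterate_mem_bracketSpan (ha : 0 < a) (s : ℝ) (m : ℕ) :
    (lap n)^[m] (bracketPow n a s) ∈ bracketSpan n a (s + m) := by
  induction m with
  | zero => simpa using bracketPow_mem_bracketSpan le_rfl
  | succ m ih =>
    rw [Function.iterate_succ_apply', Nat.cast_succ, ← add_assoc]
    exact lap_mem_bracketSpan ha ih

lemma integral_lap_iterate_mul_lap_iterate (hn : 0 < n) (ha : 0 < a) (s : ℝ) (k : ℕ)
    (hs : (n : ℝ) < 2 * (2 * s + k)) {i j : ℕ} (hij : i + j = k) :
    ∫ x, (lap n)^[i] (bracketPow n a s) x * (lap n)^[j] (bracketPow n a s) x =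
      ∫ x, bracketPow n a s x * (lap n)^[k] (bracketPow n a s) x := by
  induction i generalizing j with
  | zero =>
    obtain rfl : j = k := by omega
    rfl
  | succ i ih =>
    rw [← ih (j := j + 1) (by omega), Function.iterate_succ_apply', Function.iterate_succ_apply']
    have hi := lap_iterate_mem_bracketSpan (n := n) ha s i
    have hj := lap_iterate_mem_bracketSpan (n := n) ha s j
    have hk : (i : ℝ) + j + 1 = k := by
      rw [← hij]
      push_cast
      ring
    rw [(integral_mul_lap_of_mem_bracketSpan hn ha (by linarith) hi hj).2.2]
    simp_rw [mul_comm (lap n _ _)]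
    rw [(integral_mul_lap_of_mem_bracketSpan hn ha (by linarith) hj hi).2.2]
    simp_rw [real_inner_comm]

end BracketPow

/-- The coefficient of `(1 + a |x|²)^{-(s + m + j)}`, divided by the rising factorial of `s`, in
`(4a)^{-m} Δ₀^m (1 + a |x|²)^{-s}` for `s = (n - 2k) / 2`. -/
noncomputable def lapCoeff (k m j : ℕ) : ℝ :=
  m.choose j * ∏ i ∈ Finset.range (m - j), ((k : ℝ) - 1 - j - i)

lemma lapCoeff_succ_zero (k m : ℕ) :
    lapCoeff k (m + 1) 0 = (k - 1 - m) * lapCoeff k m 0 := by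
  simp only [lapCoeff, Nat.choose_zero_right, Nat.sub_zero, Finset.prod_range_succ]
  push_cast
  ring

lemma lapCoeff_succ_succ (k m j : ℕ) :
    lapCoeff k (m + 1) (j + 1) =
      (k - 1 - m - (j + 1)) * lapCoeff k m (j + 1) + lapCoeff k m j := by
  rcases lt_trichotomy m j with h | rfl | h
  · simp [lapCoeff, Nat.choose_eq_zero_of_lt, h, Nat.lt_succ_of_lt h]
  · simp [lapCoeff]
  · obtain ⟨e, rfl⟩ : ∃ e, m = j + 1 + e := ⟨m - (j + 1), by omega⟩
    have hc := Nat.choose_succ_right_eq (j + 1 + e) j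
    have hc' : ((j + 1 + e).choose (j + 1) : ℝ) * (j + 1) = (j + 1 + e).choose j * (e + 1) := by
      rw [show j + 1 + e - j = e + 1 by omega] at hc
      exact_mod_cast hc
    simp only [lapCoeff, Nat.choose_succ_succ, show j + 1 + e + 1 - (j + 1) = e + 1 by omega,
      show j + 1 + e - (j + 1) = e by omega, show j + 1 + e - j = e + 1 by omega]
    have hp : ∏ i ∈ Finset.range (e + 1), ((k : ℝ) - 1 - j - i) =
        (k - 1 - j) * ∏ i ∈ Finset.range e, ((k : ℝ) - 1 - (j + 1 : ℕ) - i) := by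
      rw [Finset.prod_range_succ', mul_comm]
      congr 1
      · push_cast
        ring
      · refine Finset.prod_congr rfl fun i _ => ?_
        push_cast
        ring
    rw [hp, Finset.prod_range_succ]
    push_cast
    linear_combination
      (∏ i ∈ Finset.range e, ((k : ℝ) - 1 - (j + 1) - i)) * hc'

lemma lapCoeff_self_of_lt {k j : ℕ} (h : j < k) : lapCoeff k k j = 0 := by
  have : ∏ i ∈ Finset.range (k - j), ((k : ℝ) - 1 - j - i) = 0 := by
    refine Finset.prod_eq_zero (i := k - 1 - j) (Finset.mem_range.2 (by omega)) ?_
    rw [Nat.cast_sub (by omega), Nat.cast_sub (by omega)]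
    push_cast
    ring
  rw [lapCoeff, this, mul_zero]

lemma lapCoeff_self (k : ℕ) : lapCoeff k k k = 1 := by
  simp [lapCoeff]

lemma lap_iterate_bracketPow {n k : ℕ} {a s : ℝ} (ha : 0 < a) (hs : 2 * s = n - 2 * k) (m : ℕ) :
    (lap n)^[m] (bracketPow n a s) = ∑ j ∈ Finset.range (m + 1),
      ((4 * a) ^ m * (∏ i ∈ Finset.range (m + j), (s + i)) * lapCoeff k m j) •
        bracketPow n a (s + m + j) := by
  induction m with
  | zero => simp [lapCoeff]
  | succ m ih =>
    rw [Function.iterate_succ_apply', ih, lap_sum]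
    swap
    · exact fun j => contDiff_const.smul (contDiff_bracketPow ha _)
    have step : ∀ j : ℕ, lap n (((4 * a) ^ m * (∏ i ∈ Finset.range (m + j), (s + i)) *
          lapCoeff k m j) • bracketPow n a (s + m + j)) =
        ((4 * a) ^ (m + 1) * (∏ i ∈ Finset.range (m + 1 + j), (s + i)) *
          ((k - 1 - m - j) * lapCoeff k m j)) • bracketPow n a (s + (m + 1 : ℕ) + j) +
        ((4 * a) ^ (m + 1) * (∏ i ∈ Finset.range (m + 1 + (j + 1)), (s + i)) *
          lapCoeff k m j) • bracketPow n a (s + (m + 1 : ℕ) + (j + 1 : ℕ)) := by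
      intro j
      rw [lap_smul _ (contDiff_bracketPow ha _), lap_bracketPow ha, smul_add, smul_smul, smul_smul,
        show m + 1 + (j + 1) = m + j + 1 + 1 by ring, show m + 1 + j = m + j + 1 by ring,
        Finset.prod_range_succ _ (m + j + 1), Finset.prod_range_succ _ (m + j)]
      push_cast
      rw [show s + m + j + 1 = s + (m + 1) + j by ring,
        show s + m + j + 2 = s + (m + 1) + (j + 1) by ring]
      congr 2
      · linear_combination (-(4 * a) ^ m * (∏ i ∈ Finset.range (m + j), (s + i)) *
          lapCoeff k m j * (2 * a * (s + m + j))) * hs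
      · ring
    simp_rw [step]
    rw [Finset.sum_add_distrib, Finset.sum_range_succ' _ (m + 1), Finset.sum_range_succ' _ m]
    have top : lapCoeff k m (m + 1) = 0 := by simp [lapCoeff]
    have shift := Finset.sum_range_succ (fun j : ℕ =>
      ((4 * a) ^ (m + 1) * (∏ i ∈ Finset.range (m + 1 + (j + 1)), (s + i)) *
        ((k - 1 - m - (j + 1 : ℕ)) * lapCoeff k m (j + 1))) •
          bracketPow n a (s + (m + 1 : ℕ) + (j + 1 : ℕ))) m
    rw [top, mul_zero, mul_zero, zero_smul, add_zero] at shift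
    rw [← shift, add_right_comm, ← Finset.sum_add_distrib]
    congr 1
    · refine Finset.sum_congr rfl fun j _ => ?_
      rw [lapCoeff_succ_succ, ← add_smul]
      congr 1
      push_cast
      ring
    · rw [lapCoeff_succ_zero]
      simp

lemma lap_iterate_self_bracketPow {n k : ℕ} {a s : ℝ} (ha : 0 < a) (hs : 2 * s = n - 2 * k) :
    (lap n)^[k] (bracketPow n a s) =
      ((4 * a) ^ k * ∏ i ∈ Finset.range (2 * k), (s + i)) • bracketPow n a (s + 2 * k) := by
  rw [lap_iterate_bracketPow ha hs, Finset.sum_eq_single k]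
  · rw [lapCoeff_self, mul_one, ← two_mul, add_assoc s, ← two_mul]
  · intro j hj hjk
    rw [lapCoeff_self_of_lt (by have := Finset.mem_range.1 hj; omega), mul_zero, zero_smul]
  · simp

lemma prod_cnk_pos {n k : ℕ} (hn : 2 * k < n) :
    0 < ∏ j ∈ Finset.range (2 * k), ((n : ℝ) + 2 * j - 2 * k) := by
  refine Finset.prod_pos fun j _ => ?_
  have : 2 * (k : ℝ) < n := by exact_mod_cast hn
  have : (0 : ℝ) ≤ j := j.cast_nonneg
  linarith

lemma cnk_pos {n k : ℕ} (hn : 2 * k < n) : 0 < cnk n k :=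
  rpow_pos_of_pos (prod_cnk_pos hn) _

lemma canonicalBubble_eq_bracketPow (n k : ℕ) :
    canonicalBubble n k = bracketPow n (cnk n k)⁻¹ ((n - 2 * k) / 2) := by
  ext x
  rw [canonicalBubble, bracketPow, ← neg_div, neg_sub]

lemma canonicalBubble_rpow_critical {n k : ℕ} (hn : 2 * k < n) (x : EuclideanSpace ℝ (Fin n)) :
    canonicalBubble n k x ^ (2 * (n : ℝ) / ((n : ℝ) - 2 * k)) = bracketPow n (cnk n k)⁻¹ n x := by
  have h : 2 * (k : ℝ) < n := by exact_mod_cast hn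
  rw [canonicalBubble_eq_bracketPow, bracketPow, bracketPow,
    ← rpow_mul (bracket_pos (inv_pos.2 (cnk_pos hn)) x).le]
  congr 1
  have := (sub_pos.2 h).ne'
  field_simp

/-- The bubble solves the critical equation `Δ₀^k B₀ = B₀^{2*_k - 1}`. -/
lemma lap_iterate_canonicalBubble {n k : ℕ} (hk : 1 ≤ k) (hn : 2 * k < n) :
    (lap n)^[k] (canonicalBubble n k) = bracketPow n (cnk n k)⁻¹ ((n + 2 * k) / 2) := by
  have hs : 2 * (((n : ℝ) - 2 * k) / 2) = n - 2 * k := by ring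
  rw [canonicalBubble_eq_bracketPow, lap_iterate_self_bracketPow (inv_pos.2 (cnk_pos hn)) hs]
  have hc : cnk n k ^ k = ∏ j ∈ Finset.range (2 * k), ((n : ℝ) + 2 * j - 2 * k) :=
    rpow_inv_natCast_pow (prod_cnk_pos hn).le (by omega)
  have hprod : ∏ j ∈ Finset.range (2 * k), ((n : ℝ) + 2 * j - 2 * k) =
      4 ^ k * ∏ i ∈ Finset.range (2 * k), (((n : ℝ) - 2 * k) / 2 + i) := by
    rw [show (4 : ℝ) = 2 ^ 2 by norm_num, ← pow_mul]
    nth_rw 2 [← Finset.card_range (2 * k)]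
    rw [← Finset.prod_const, ← Finset.prod_mul_distrib]
    refine Finset.prod_congr rfl fun i _ => ?_
    ring
  have hone : (4 * (cnk n k)⁻¹) ^ k *
      ∏ i ∈ Finset.range (2 * k), (((n : ℝ) - 2 * k) / 2 + i) = 1 := by
    rw [mul_pow, mul_right_comm, ← hprod, ← hc, ← mul_pow, mul_inv_cancel₀ (cnk_pos hn).ne',
      one_pow]
  rw [hone, one_smul]
  congr 1
  ring

theorem stmt1 (k n : ℕ) (hk : 1 ≤ k) (hn : 2 * k < n) :
    Integrable (fun x : EuclideanSpace ℝ (Fin n) =>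
      canonicalBubble n k x ^ (2 * (n : ℝ) / ((n : ℝ) - 2 * k))) ∧
    (Even k →
      Integrable (fun x : EuclideanSpace ℝ (Fin n) =>
        ((lap n)^[k / 2] (canonicalBubble n k) x) ^ 2) ∧
      ∫ x : EuclideanSpace ℝ (Fin n), ((lap n)^[k / 2] (canonicalBubble n k) x) ^ 2 =
        ∫ x : EuclideanSpace ℝ (Fin n),
          canonicalBubble n k x ^ (2 * (n : ℝ) / ((n : ℝ) - 2 * k))) ∧
    (Odd k →
      Integrable (fun x : EuclideanSpace ℝ (Fin n) =>
        ‖gradient ((lap n)^[(k - 1) / 2] (canonicalBubble n k)) x‖ ^ 2) ∧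
      ∫ x : EuclideanSpace ℝ (Fin n),
          ‖gradient ((lap n)^[(k - 1) / 2] (canonicalBubble n k)) x‖ ^ 2 =
        ∫ x : EuclideanSpace ℝ (Fin n),
          canonicalBubble n k x ^ (2 * (n : ℝ) / ((n : ℝ) - 2 * k))) := by
  have ha : 0 < (cnk n k)⁻¹ := inv_pos.2 (cnk_pos hn)
  have hn0 : 0 < n := by omega
  have h2k : 2 * (k : ℝ) < n := by exact_mod_cast hn
  have hcrit : (n : ℝ) < 2 * (2 * (((n : ℝ) - 2 * k) / 2) + k) := by linarith
  have energy : ∀ i j : ℕ, i + j = k →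
      ∫ x, (lap n)^[i] (canonicalBubble n k) x * (lap n)^[j] (canonicalBubble n k) x =
        ∫ x, bracketPow n (cnk n k)⁻¹ n x := by
    intro i j hij
    rw [canonicalBubble_eq_bracketPow,
      integral_lap_iterate_mul_lap_iterate hn0 ha _ k hcrit hij,
      ← canonicalBubble_eq_bracketPow, lap_iterate_canonicalBubble hk hn]
    simp_rw [canonicalBubble_eq_bracketPow, bracketPow_mul ha]
    ring_nf
  have pairing : ∀ i j : ℕ, i + j + 1 = k → _ := fun i j hij =>
    integral_mul_lap_of_mem_bracketSpan hn0 ha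
      (by have : (i : ℝ) + j + 1 = k := by exact_mod_cast hij
          linarith)
      (lap_iterate_mem_bracketSpan (n := n) ha (((n : ℝ) - 2 * k) / 2) i)
      (lap_iterate_mem_bracketSpan (n := n) ha (((n : ℝ) - 2 * k) / 2) j)
  simp_rw [← canonicalBubble_eq_bracketPow, ← Function.iterate_succ_apply' (lap n)] at pairing
  simp_rw [canonicalBubble_rpow_critical hn]
  refine ⟨integrable_bracketPow ha (by linarith [n.cast_nonneg (α := ℝ)]), ?_, ?_⟩
  · rintro ⟨m, hm⟩
    have hm2 : k / 2 = m := by omega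
    obtain ⟨l, rfl⟩ : ∃ l, m = l + 1 := ⟨m - 1, by omega⟩
    simp_rw [hm2, sq]
    exact ⟨(pairing (l + 1) l (by omega)).1, energy _ _ (by omega)⟩
  · rintro ⟨m, hm⟩
    have hm2 : (k - 1) / 2 = m := by omega
    simp_rw [hm2, ← real_inner_self_eq_norm_sq]
    obtain ⟨-, hI, heq⟩ := pairing m m (by omega)
    exact ⟨hI, heq ▸ energy _ _ (by omega)⟩
end

section
/- Let k ≥ 1 and n > 2k be integers. There exists a constant C = C(n, k) > 0 such that for all real numbers 0 < δ < 1, all 0 < μ₁ ≤ δ and 0 < μ₂ ≤ δ, and every Θ ∈ ℝⁿ, one has (μ₁μ₂)^{(n−2k)/2} · δ^{−2k} · ∫_{B(0, 2δ) ∖ B(0, δ)} |x − Θ|^{2k−n} dx ≤ C · (μ₁μ₂/(μ₁² + |Θ|²))^{(n−2k)/2} · δ^{n−2k}. -/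
open MeasureTheory Real
open scoped Pointwise

theorem locallyIntegrable_norm_rpow_neg {n : ℕ} (hn : 1 ≤ n) {a : ℝ} (ha : a < n) :
    LocallyIntegrable (fun x : EuclideanSpace ℝ (Fin n) => ‖x‖ ^ (-a)) := by
  refine locallyIntegrable_of_norm_le_rpow (C := 1) (α := a) ?_ ?_ ?_ ?_
  · simpa using hn
  · simpa using ha
  · refine Filter.Eventually.of_forall fun x => ?_
    rw [one_mul, Real.norm_of_nonneg (by positivity)]
  · exact (measurable_norm.pow_const _).aestronglyMeasurable

theorem setIntegral_ball_norm_rpow_neg {n : ℕ} (a : ℝ) {R : ℝ} (hR : 0 < R) :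
    ∫ x in Metric.ball (0 : EuclideanSpace ℝ (Fin n)) R, ‖x‖ ^ (-a) =
      R ^ n * R ^ (-a) * ∫ x in Metric.ball (0 : EuclideanSpace ℝ (Fin n)) 1, ‖x‖ ^ (-a) := by
  have h := Measure.setIntegral_comp_smul_of_pos (volume : Measure (EuclideanSpace ℝ (Fin n)))
    (fun x => ‖x‖ ^ (-a)) (Metric.ball 0 1) hR
  have hball : R • Metric.ball (0 : EuclideanSpace ℝ (Fin n)) 1 = Metric.ball 0 R := by
    rw [smul_unitBall hR.ne', Real.norm_of_nonneg hR.le]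
  simp only [hball, norm_smul, Real.norm_of_nonneg hR.le, finrank_euclideanSpace_fin,
    smul_eq_mul] at h
  simp_rw [Real.mul_rpow hR.le (norm_nonneg _)] at h
  rw [integral_const_mul] at h
  rw [mul_assoc, h, mul_inv_cancel_left₀ (by positivity)]

/-- The Riesz potential of an annulus of radius `δ` is at most a constant multiple of
`δ ^ n * (δ ^ 2 + ‖Θ‖ ^ 2) ^ (-a / 2)`, uniformly in the pole `Θ`. -/
theorem exists_setIntegral_annulus_norm_sub_rpow_neg_le {n : ℕ} {a : ℝ} (ha : 0 < a)
    (han : a < n) :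
    ∃ C : ℝ, 0 < C ∧ ∀ δ : ℝ, 0 < δ → ∀ Θ : EuclideanSpace ℝ (Fin n),
      ∫ x in Metric.ball (0 : EuclideanSpace ℝ (Fin n)) (2 * δ) \ Metric.ball 0 δ,
        ‖x - Θ‖ ^ (-a) ≤ C * δ ^ n * (δ ^ 2 + ‖Θ‖ ^ 2) ^ (-(a / 2)) := by
  have hn : 1 ≤ n := by
    have : (0 : ℝ) < n := ha.trans han
    exact_mod_cast this
  have : Nonempty (Fin n) := ⟨⟨0, hn⟩⟩
  let E := EuclideanSpace ℝ (Fin n)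
  set I : ℝ := ∫ x in Metric.ball (0 : E) 1, ‖x‖ ^ (-a)
  set V : ℝ := volume.real (Metric.ball (0 : E) 1) with hV
  have hI0 : 0 ≤ I := setIntegral_nonneg measurableSet_ball fun x _ => by positivity
  have hV0 : 0 ≤ V := measureReal_nonneg
  refine ⟨6 ^ n * I + 4 ^ a * 2 ^ n * V + 1, by positivity, fun δ hδ Θ => ?_⟩
  have hS : ∀ {t : ℝ}, 0 < t → δ ^ 2 + ‖Θ‖ ^ 2 ≤ t ^ 2 →
      t ^ (-a) ≤ (δ ^ 2 + ‖Θ‖ ^ 2) ^ (-(a / 2)) := fun {t} ht h => by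
    have h2 : t ^ (-a) = (t ^ 2) ^ (-(a / 2)) := by
      rw [← Real.rpow_natCast, ← Real.rpow_mul ht.le]
      congr 1
      push_cast
      ring
    rw [h2]
    exact Real.rpow_le_rpow_of_nonpos (by positivity) h (by linarith)
  set S := (δ ^ 2 + ‖Θ‖ ^ 2) ^ (-(a / 2))
  have hS0 : 0 < S := by positivity
  rcases lt_or_ge ‖Θ‖ (4 * δ) with hΘ | hΘ
  · have hsub : Metric.ball (0 : E) (2 * δ) \ Metric.ball 0 δ ⊆ Metric.ball Θ (6 * δ) := by
      rintro x ⟨hx, -⟩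
      rw [mem_ball_iff_norm] at hx ⊢
      rw [sub_zero] at hx
      linarith [norm_sub_le x Θ]
    have hpre : (fun x : E => x - Θ) ⁻¹' Metric.ball 0 (6 * δ) = Metric.ball Θ (6 * δ) := by
      ext x
      simp [dist_eq_norm]
    have hmp := measurePreserving_sub_right (volume : Measure E) Θ
    have hemb := (MeasurableEquiv.subRight Θ).measurableEmbedding
    have hint : IntegrableOn (fun x : E => ‖x - Θ‖ ^ (-a)) (Metric.ball Θ (6 * δ)) := by
      rw [← hpre]
      refine (hmp.integrableOn_comp_preimage hemb (f := fun x : E => ‖x‖ ^ (-a))).2 ?_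
      exact ((locallyIntegrable_norm_rpow_neg hn han).integrableOn_isCompact
        (isCompact_closedBall 0 (6 * δ))).mono_set Metric.ball_subset_closedBall
    have heq : ∫ x in Metric.ball Θ (6 * δ), ‖x - Θ‖ ^ (-a) =
        ∫ x in Metric.ball (0 : E) (6 * δ), ‖x‖ ^ (-a) := by
      rw [← hpre]
      exact hmp.setIntegral_preimage_emb hemb (fun x : E => ‖x‖ ^ (-a)) _
    calc _ ≤ ∫ x in Metric.ball Θ (6 * δ), ‖x - Θ‖ ^ (-a) :=
          setIntegral_mono_set hint (Filter.Eventually.of_forall fun x => by positivity)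
            hsub.eventuallyLE
      _ = (6 * δ) ^ n * (6 * δ) ^ (-a) * I := by
          rw [heq, setIntegral_ball_norm_rpow_neg a (by positivity)]
      _ ≤ (6 * δ) ^ n * S * I := by
          gcongr
          exact hS (by positivity) (by nlinarith [norm_nonneg Θ])
      _ = (6 ^ n * I) * δ ^ n * S := by rw [mul_pow]; ring
      _ ≤ _ := by
          gcongr
          linarith [show 0 ≤ 4 ^ a * 2 ^ n * V by positivity]
  · have hΘ0 : 0 < ‖Θ‖ := by linarith
    have hvol : volume.real (Metric.ball (0 : E) (2 * δ)) = (2 * δ) ^ n * V := by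
      rw [measureReal_def, Measure.addHaar_ball _ _ (by positivity), ENNReal.toReal_mul,
        ENNReal.toReal_ofReal (by positivity), finrank_euclideanSpace_fin, hV, measureReal_def]
    have hbd : ∀ x ∈ Metric.ball (0 : E) (2 * δ) \ Metric.ball 0 δ,
        ‖‖x - Θ‖ ^ (-a)‖ ≤ (‖Θ‖ / 2) ^ (-a) := by
      rintro x ⟨hx, -⟩
      rw [mem_ball_iff_norm, sub_zero] at hx
      rw [Real.norm_of_nonneg (by positivity)]
      refine Real.rpow_le_rpow_of_nonpos (by positivity) ?_ (by linarith)
      have := norm_sub_norm_le Θ x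
      rw [norm_sub_rev] at this
      linarith
    have hfin : volume (Metric.ball (0 : E) (2 * δ) \ Metric.ball 0 δ) < ⊤ :=
      (measure_mono Set.sdiff_subset).trans_lt measure_ball_lt_top
    calc _ ≤ (‖Θ‖ / 2) ^ (-a) * volume.real (Metric.ball (0 : E) (2 * δ) \ Metric.ball 0 δ) :=
          (le_abs_self _).trans (norm_setIntegral_le_of_norm_le_const hfin hbd)
      _ ≤ (‖Θ‖ / 2) ^ (-a) * ((2 * δ) ^ n * V) := by
          rw [← hvol]
          gcongr
          · exact measure_ball_lt_top.ne
          · exact Set.sdiff_subset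
      _ = 4 ^ a * (2 * ‖Θ‖) ^ (-a) * ((2 * δ) ^ n * V) := by
          congr 1
          rw [show ‖Θ‖ / 2 = 4⁻¹ * (2 * ‖Θ‖) by ring, Real.mul_rpow (by norm_num) (by positivity),
            Real.inv_rpow (by norm_num), Real.rpow_neg (by norm_num), inv_inv]
      _ ≤ 4 ^ a * S * ((2 * δ) ^ n * V) := by
          gcongr
          exact hS (by positivity) (by nlinarith)
      _ = (4 ^ a * 2 ^ n * V) * δ ^ n * S := by rw [mul_pow]; ring
      _ ≤ _ := by
          gcongr
          linarith [mul_nonneg (show (0 : ℝ) ≤ 6 ^ n by positivity) hI0]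

theorem stmt10 (k n : ℕ) (hk : 1 ≤ k) (hn : 2 * k < n) :
    ∃ C : ℝ, 0 < C ∧
      ∀ δ μ₁ μ₂ : ℝ, 0 < δ → δ < 1 → 0 < μ₁ → μ₁ ≤ δ → 0 < μ₂ → μ₂ ≤ δ →
      ∀ Θ : EuclideanSpace ℝ (Fin n),
        (μ₁ * μ₂) ^ (((n : ℝ) - 2 * k) / 2) * δ ^ (-(2 * (k : ℝ))) *
            ∫ x in Metric.ball (0 : EuclideanSpace ℝ (Fin n)) (2 * δ) \
                Metric.ball (0 : EuclideanSpace ℝ (Fin n)) δ,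
              ‖x - Θ‖ ^ ((2 * (k : ℝ)) - n) ≤
          C * (μ₁ * μ₂ / (μ₁ ^ 2 + ‖Θ‖ ^ 2)) ^ (((n : ℝ) - 2 * k) / 2) *
            δ ^ ((n : ℝ) - 2 * k) := by
  have hk' : (1 : ℝ) ≤ k := by exact_mod_cast hk
  have hn' : 2 * (k : ℝ) < n := by exact_mod_cast hn
  obtain ⟨C, hC, hbound⟩ := exists_setIntegral_annulus_norm_sub_rpow_neg_le (n := n)
    (a := (n : ℝ) - 2 * k) (by linarith) (by linarith)
  refine ⟨C, hC, fun δ μ₁ μ₂ hδ _ hμ₁ hμ₁δ hμ₂ _ Θ => ?_⟩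
  have h := hbound δ hδ Θ
  rw [neg_sub] at h
  have hmono : (δ ^ 2 + ‖Θ‖ ^ 2) ^ (-(((n : ℝ) - 2 * k) / 2)) ≤
      (μ₁ ^ 2 + ‖Θ‖ ^ 2) ^ (-(((n : ℝ) - 2 * k) / 2)) :=
    Real.rpow_le_rpow_of_nonpos (by positivity) (by gcongr) (by linarith)
  calc _ ≤ (μ₁ * μ₂) ^ (((n : ℝ) - 2 * k) / 2) * δ ^ (-(2 * (k : ℝ))) *
        (C * δ ^ n * (μ₁ ^ 2 + ‖Θ‖ ^ 2) ^ (-(((n : ℝ) - 2 * k) / 2))) := by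
        gcongr
        exact h.trans (by gcongr)
    _ = _ := by
        rw [Real.div_rpow (by positivity) (by positivity),
          sub_eq_add_neg (n : ℝ), Real.rpow_add hδ, Real.rpow_natCast,
          Real.rpow_neg (x := μ₁ ^ 2 + ‖Θ‖ ^ 2) (by positivity)]
        ring
end
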